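/- For every n ≥ 0 and all real numbers x, t: Σ_{π ∈ S_{n+1}, simsuc(π)=0} x^{basc(π)} t^{plrmin(π)} = Σ_{σ ∈ S_n} x^{exc(σ)} t^{fix(σ)}. -/

import Mathlib

open Finset

namespace SucEuler

/-- One-line notation word of a permutation: `word π i` is the value (in `1..n`)
at position `i ∈ {1,…,n}`, and `0` for positions outside `{1,…,n}`
(this implements the conventions `π(0)=π(n+1)=0`). -/
def word {n : ℕ} (π : Equiv.Perm (Fin n)) (i : ℕ) : ℕ :=
  if h : 1 ≤ i ∧ i ≤ n then ((π ⟨i - 1, by omega⟩ : Fin n) : ℕ) + 1 else 0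

/-- number of descents -/
def des {n : ℕ} (π : Equiv.Perm (Fin n)) : ℕ :=
  ((Finset.Icc 1 (n - 1)).filter fun i => word π (i + 1) < word π i).card

/-- number of ascents -/
def asc {n : ℕ} (π : Equiv.Perm (Fin n)) : ℕ :=
  ((Finset.Icc 1 (n - 1)).filter fun i => word π i < word π (i + 1)).card

/-- number of successions -/
def suc {n : ℕ} (π : Equiv.Perm (Fin n)) : ℕ :=
  ((Finset.Icc 1 (n - 1)).filter fun i => word π (i + 1) = word π i + 1).card

/-- number of big ascents -/
def basc {n : ℕ} (π : Equiv.Perm (Fin n)) : ℕ :=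
  ((Finset.Icc 1 (n - 1)).filter fun i => word π i + 2 ≤ word π (i + 1)).card

/-- number of excedances -/
def excStat {n : ℕ} (σ : Equiv.Perm (Fin n)) : ℕ :=
  (Finset.univ.filter fun i : Fin n => i < σ i).card

/-- number of fixed points -/
def fixStat {n : ℕ} (σ : Equiv.Perm (Fin n)) : ℕ :=
  (Finset.univ.filter fun i : Fin n => σ i = i).card

/-- number of drops -/
def dropStat {n : ℕ} (σ : Equiv.Perm (Fin n)) : ℕ :=
  (Finset.univ.filter fun i : Fin n => σ i < i).card

/-- number of excedances at positions `i ≥ 2` -/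
def excHat {n : ℕ} (σ : Equiv.Perm (Fin n)) : ℕ :=
  (Finset.univ.filter fun i : Fin n => 0 < (i : ℕ) ∧ i < σ i).card

/-- number of fixed points other than `1` -/
def fixHat {n : ℕ} (σ : Equiv.Perm (Fin n)) : ℕ :=
  (Finset.univ.filter fun i : Fin n => 0 < (i : ℕ) ∧ σ i = i).card

/-- number of cycles (orbits) of a permutation -/
def cyc {n : ℕ} (σ : Equiv.Perm (Fin n)) : ℕ :=
  σ.cycleType.card + fixStat σ

/-- number of cycle double ascents: values `x` with `σ⁻¹(x) < x < σ(x)` -/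
def cda {n : ℕ} (σ : Equiv.Perm (Fin n)) : ℕ :=
  (Finset.univ.filter fun x : Fin n => σ⁻¹ x < x ∧ x < σ x).card

open Classical in
/-- number of left-to-right minima -/
noncomputable def lrmin {n : ℕ} (π : Equiv.Perm (Fin n)) : ℕ :=
  ((Finset.Icc 1 n).filter fun i => ∀ j ∈ Finset.Icc 1 n, j < i → word π i < word π j).card

open Classical in
/-- number of proper left-to-right minima -/
noncomputable def plrmin {n : ℕ} (π : Equiv.Perm (Fin n)) : ℕ :=
  ((Finset.Icc 1 n).filter fun i =>
    (∀ j ∈ Finset.Icc 1 n, j < i → word π i < word π j) ∧ word π i ≠ 1 ∧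
      ∃ k ∈ Finset.Icc 1 n, i < k ∧ word π k = word π i - 1 ∧ word π (k + 1) < word π k).card

open Classical in
/-- number of simsun successions -/
noncomputable def simsuc {n : ℕ} (π : Equiv.Perm (Fin n)) : ℕ :=
  ((Finset.Icc 1 n).filter fun i =>
    ∃ j ∈ Finset.Icc 1 n, i < j ∧ word π j = word π i + 1 ∧
      ∀ k ∈ Finset.Icc 1 n, i < k → k < j → word π i + 1 < word π k).card

/-- number of peaks (with the boundary conventions `π(0)=π(n+1)=0`) -/
def pk {n : ℕ} (π : Equiv.Perm (Fin n)) : ℕ :=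
  ((Finset.Icc 1 n).filter fun i => word π (i - 1) < word π i ∧ word π (i + 1) < word π i).card

/-- number of valleys -/
def valStat {n : ℕ} (π : Equiv.Perm (Fin n)) : ℕ :=
  ((Finset.Icc 1 n).filter fun i => word π i < word π (i - 1) ∧ word π i < word π (i + 1)).card

/-- number of double ascents -/
def dasc {n : ℕ} (π : Equiv.Perm (Fin n)) : ℕ :=
  ((Finset.Icc 1 n).filter fun i => word π (i - 1) < word π i ∧ word π i < word π (i + 1)).card

/-- number of double descents -/
def ddes {n : ℕ} (π : Equiv.Perm (Fin n)) : ℕ :=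
  ((Finset.Icc 1 n).filter fun i => word π (i + 1) < word π i ∧ word π i < word π (i - 1)).card

open Classical in
/-- `nextVal σ m x` is the (0-indexed) first value `≤ m` (i.e. `< m` in 0-indexed terms)
in the forward orbit of `x` under `σ`: it equals `σ^t(x)` for the minimal `t ≥ 1`
with `σ^t(x) < m`, when such `t` exists. This is the action of the permutation `σ_k`
(with `m = n - k`) obtained by removing the `k` largest letters from the cycles of `σ`. -/
noncomputable def nextVal {n : ℕ} (σ : Equiv.Perm (Fin n)) (m : ℕ) (x : Fin n) : ℕ :=
  if h : ∃ t : ℕ, 0 < t ∧ (((σ ^ t) x : Fin n) : ℕ) < m then (((σ ^ Nat.find h) x : Fin n) : ℕ)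
  else 0

/-- `σ` is a simsun permutation of the second kind: for every `0 ≤ k ≤ n-1`, the
permutation of `[n-k]` obtained from `σ` by removing the `k` largest letters has
no cycle double ascents. (Here `m = n - k` and values are 0-indexed.) -/
def IsSimsun2 {n : ℕ} (σ : Equiv.Perm (Fin n)) : Prop :=
  ∀ m ≤ n, ∀ x : Fin n, (x : ℕ) < m →
    ¬ (nextVal σ⁻¹ m x < (x : ℕ) ∧ (x : ℕ) < nextVal σ m x)

noncomputable instance {n : ℕ} : DecidablePred (IsSimsun2 (n := n)) :=
  fun _ => Classical.propDecidable _

/-- the derangement polynomial `d_n(x)` -/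
def dpoly (n : ℕ) (x : ℝ) : ℝ :=
  ∑ σ ∈ Finset.univ.filter fun σ : Equiv.Perm (Fin n) => fixStat σ = 0, x ^ excStat σ

/-- the Eulerian polynomial `A_n(x)` -/
def eulerian (n : ℕ) (x : ℝ) : ℝ :=
  ∑ π : Equiv.Perm (Fin n), x ^ des π


/-! ### Helper material -/

def insW (m p : ℕ) (w : ℕ → ℕ) (i : ℕ) : ℕ :=
  if i ≤ p then w i else if i = p + 1 then m + 1 else w (i - 1)

def shP (p i : ℕ) : ℕ := if i ≤ p then i else i + 1

lemma shP_inj (p : ℕ) : Function.Injective (shP p) := by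
  intro a b h
  simp only [shP] at h
  split_ifs at h <;> omega

lemma shP_ne (p i : ℕ) : shP p i ≠ p + 1 := by
  simp only [shP]; split_ifs <;> omega

lemma shP_lt {p i j : ℕ} : shP p i < shP p j ↔ i < j := by
  simp only [shP]; split_ifs <;> omega

lemma shP_mem {m p i : ℕ} (hp : p ≤ m) : (1 ≤ shP p i ∧ shP p i ≤ m + 1) ↔ (1 ≤ i ∧ i ≤ m) := by
  simp only [shP]; split_ifs <;> omega

lemma shP_cases (p k : ℕ) : k = p + 1 ∨ ∃ i, k = shP p i := by
  rcases lt_trichotomy k (p + 1) with h | h | h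
  · exact Or.inr ⟨k, by simp only [shP]; split_ifs <;> omega⟩
  · exact Or.inl h
  · exact Or.inr ⟨k - 1, by simp only [shP]; split_ifs <;> omega⟩

lemma insW_sh (m p : ℕ) (w : ℕ → ℕ) (i : ℕ) : insW m p w (shP p i) = w i := by
  simp only [shP, insW]
  split_ifs <;> first | rfl | omega

lemma insW_p (m p : ℕ) (w : ℕ → ℕ) : insW m p w (p + 1) = m + 1 := by
  simp [insW]

lemma insW_sh_succ (m p : ℕ) (w : ℕ → ℕ) (i : ℕ) (h : i ≠ p) :
    insW m p w (shP p i + 1) = w (i + 1) := by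
  have : shP p i + 1 = shP p (i + 1) := by simp only [shP]; split_ifs <;> omega
  rw [this, insW_sh]

lemma insW_p_succ (m p : ℕ) (w : ℕ → ℕ) : insW m p w (shP p p + 1) = m + 1 := by
  simp [insW, shP]

lemma insW_pp (m p : ℕ) (w : ℕ → ℕ) : insW m p w (p + 1 + 1) = w (p + 1) := by
  simp [insW]

structure GoodW (m : ℕ) (w : ℕ → ℕ) : Prop where
  pos : ∀ i, 1 ≤ i → i ≤ m → 1 ≤ w i
  le : ∀ i, w i ≤ m
  out : ∀ i, ¬ (1 ≤ i ∧ i ≤ m) → w i = 0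
  inj : ∀ i j, 1 ≤ i → i ≤ m → w i = w j → i = j
  surj : ∀ v, 1 ≤ v → v ≤ m → ∃ i, 1 ≤ i ∧ i ≤ m ∧ w i = v

lemma goodW_word {m : ℕ} (π : Equiv.Perm (Fin m)) : GoodW m (word π) where
  pos i h1 h2 := by simp [word, h1, h2]
  le i := by
    simp only [word]; split_ifs with h
    · exact (π _).isLt
    · omega
  out i h := by simp [word, h]
  inj i j h1 h2 h := by
    simp only [word, h1, h2, and_self, dite_true] at h
    split_ifs at h with h3
    have h4 : π ⟨i - 1, by omega⟩ = π ⟨j - 1, by omega⟩ := by ext; omega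
    have := congrArg Fin.val (π.injective h4)
    simp at this
    omega
  surj v h1 h2 := by
    refine ⟨(π.symm ⟨v - 1, by omega⟩ : ℕ) + 1, by omega, by omega, ?_⟩
    have : (π.symm ⟨v - 1, by omega⟩ : ℕ) + 1 ≤ m := by omega
    simp [word, this]
    omega

def Bset (m : ℕ) (w : ℕ → ℕ) : Finset ℕ := (Icc 1 m).filter fun i => w i + 2 ≤ w (i + 1)

def PP (w : ℕ → ℕ) (k : ℕ) : Prop :=
  w (k + 1) < w k ∧ ∃ i, 1 ≤ i ∧ i < k ∧ w i = w k + 1 ∧ ∀ j, 1 ≤ j → j < i → w i < w j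

open Classical in
noncomputable def Pset (m : ℕ) (w : ℕ → ℕ) : Finset ℕ := (Icc 1 m).filter fun k => PP w k

lemma mf {α : Type*} (p : α → Prop) (inst : DecidablePred p) (s : Finset α) (a : α) :
    a ∈ @Finset.filter α p inst s ↔ a ∈ s ∧ p a := mem_filter

lemma mem_Pset (m : ℕ) (w : ℕ → ℕ) (k : ℕ) : k ∈ Pset m w ↔ (1 ≤ k ∧ k ≤ m) ∧ PP w k := by
  unfold Pset
  rw [mf, mem_Icc]

def SS (m : ℕ) (w : ℕ → ℕ) : Prop :=
  ∃ i j, 1 ≤ i ∧ i < j ∧ j ≤ m ∧ w j = w i + 1 ∧ ∀ k, i < k → k < j → w i + 1 < w k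

lemma basc_eq {m : ℕ} (π : Equiv.Perm (Fin m)) : basc π = (Bset m (word π)).card := by
  unfold basc Bset
  congr 1
  ext i
  simp only [mem_filter, mem_Icc]
  constructor
  · rintro ⟨h, h'⟩; exact ⟨by omega, h'⟩
  · rintro ⟨h, h'⟩
    refine ⟨⟨h.1, ?_⟩, h'⟩
    by_contra hc
    have := (goodW_word π).out (i + 1) (by omega)
    omega

lemma simsuc_eq {m : ℕ} (π : Equiv.Perm (Fin m)) : simsuc π = 0 ↔ ¬ SS m (word π) := by
  classical
  unfold simsuc SS
  rw [card_eq_zero, eq_empty_iff_forall_notMem]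
  simp only [mf, mem_Icc, not_and]
  constructor
  · rintro h ⟨i, j, h1, h2, h3, h4, h5⟩
    exact h i ⟨h1, by omega⟩ ⟨j, ⟨by omega, h3⟩, h2, h4, fun k _ => h5 k⟩
  · rintro h i hi ⟨j, hj, h2, h3, h4⟩
    exact h ⟨i, j, hi.1, h2, hj.2, h3, fun k hk hk' => h4 k ⟨by omega, by omega⟩ hk hk'⟩

lemma plrmin_eq {m : ℕ} (π : Equiv.Perm (Fin m)) : plrmin π = (Pset m (word π)).card := by
  classical
  have G := goodW_word π
  unfold plrmin
  generalize word π = w at *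
  rw [← card_image_of_injOn (s := Pset m w) (f := fun k => w k + 1)]
  · rw [← card_image_of_injOn (f := w)]
    · congr 1
      ext v
      simp only [mem_image, mf, mem_Pset, mem_Icc, PP]
      constructor
      · rintro ⟨i, ⟨hi, h1, h2, k, hk, h3, h4, h5⟩, rfl⟩
        have := G.pos i hi.1 hi.2
        exact ⟨k, ⟨hk, h5, i, hi.1, h3, by omega, fun j hj hj' => h1 j ⟨hj, by omega⟩ hj'⟩,
          by omega⟩
      · rintro ⟨k, ⟨hk, h1, i, h2, h3, h4, h5⟩, rfl⟩
        have := G.pos k hk.1 hk.2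
        exact ⟨i, ⟨⟨h2, by omega⟩, fun j hj hj' => h5 j hj.1 hj', by omega, k, hk, h3, by omega,
          h1⟩, h4⟩
    · intro a ha b hb h
      simp only [mem_coe, mf, mem_Icc] at ha hb
      exact G.inj a b ha.1.1 ha.1.2 h
  · intro a ha b hb h
    simp only [mem_coe, mem_Pset] at ha hb
    exact G.inj a b ha.1.1 ha.1.2 (by simpa using h)

lemma SS_ins {m p : ℕ} {w : ℕ → ℕ} (G : GoodW m w) (hp : p ≤ m) :
    SS (m + 1) (insW m p w) ↔ (SS m w ∨ (1 ≤ p ∧ w p = m)) := by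
  constructor
  · rintro ⟨i, j, h1, h2, h3, h4, h5⟩
    rcases shP_cases p i with rfl | ⟨i, rfl⟩
    · rw [insW_p] at h4
      rcases shP_cases p j with rfl | ⟨j, rfl⟩
      · omega
      · rw [insW_sh] at h4
        have := G.le j; omega
    · rw [insW_sh] at h4 h5
      have hi := (shP_mem (i := i) hp).1 ⟨h1, by omega⟩
      rcases shP_cases p j with rfl | ⟨j, rfl⟩
      · rw [insW_p] at h4
        right
        have hip : i ≤ p := by
          simp only [shP] at h2; split_ifs at h2 <;> omega
        rcases hip.lt_or_eq with h | h
        · have h6 := h5 (shP p p) (shP_lt.2 h) (by simp [shP])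
          rw [insW_sh] at h6
          have := G.le p; omega
        · subst h; exact ⟨hi.1, by omega⟩
      · left
        rw [insW_sh] at h4
        have hj := (shP_mem (i := j) hp).1 ⟨by omega, h3⟩
        refine ⟨i, j, hi.1, shP_lt.1 h2, hj.2, h4, fun k hk hk' => ?_⟩
        have := h5 (shP p k) (shP_lt.2 hk) (shP_lt.2 hk')
        rwa [insW_sh] at this
  · rintro (⟨i, j, h1, h2, h3, h4, h5⟩ | ⟨h1, h2⟩)
    · refine ⟨shP p i, shP p j, ((shP_mem hp).2 ⟨h1, by omega⟩).1, shP_lt.2 h2,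
        ((shP_mem hp).2 ⟨by omega, h3⟩).2, by rw [insW_sh, insW_sh, h4], fun k hk hk' => ?_⟩
      rw [insW_sh]
      rcases shP_cases p k with rfl | ⟨k, rfl⟩
      · rw [insW_p]; have := G.le j; omega
      · rw [insW_sh]; exact h5 k (shP_lt.1 hk) (shP_lt.1 hk')
    · refine ⟨p, p + 1, h1, by omega, by omega, ?_, fun k _ _ => by omega⟩
      rw [insW_p]; simp [insW, h2]

lemma Bset_ins_zero {m : ℕ} {w : ℕ → ℕ} (G : GoodW m w) :
    (Bset (m + 1) (insW m 0 w)).card = (Bset m w).card := by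
  rw [← card_image_of_injective (Bset m w) (shP_inj 0)]
  congr 1
  ext k
  simp only [Bset, mem_filter, mem_Icc, mem_image]
  rcases shP_cases 0 k with rfl | ⟨i, rfl⟩
  · rw [insW_p, insW_pp]
    have := G.le (0 + 1)
    constructor
    · intro h; omega
    · rintro ⟨a, _, h⟩; exact absurd h (shP_ne _ _)
  · rw [shP_mem (Nat.zero_le _), insW_sh]
    constructor
    · rintro ⟨h, h'⟩; rw [insW_sh_succ _ _ _ _ (by omega)] at h'; exact ⟨i, ⟨h, h'⟩, rfl⟩
    · rintro ⟨a, ⟨h, h'⟩, e⟩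
      obtain rfl := shP_inj _ e
      rw [insW_sh_succ _ _ _ _ (by omega)]; exact ⟨h, h'⟩

lemma Bset_ins {m p : ℕ} {w : ℕ → ℕ} (G : GoodW m w) (hp1 : 1 ≤ p) (hp : p ≤ m) (hw : w p ≠ m) :
    (Bset (m + 1) (insW m p w)).card = ((Bset m w).erase p).card + 1 := by
  rw [← card_insert_of_notMem (notMem_erase p _), ← card_image_of_injective (insert _ _) (shP_inj p)]
  congr 1
  ext k
  simp only [Bset, mem_filter, mem_Icc, mem_image, mem_insert, mem_erase]
  rcases shP_cases p k with rfl | ⟨i, rfl⟩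
  · rw [insW_p, insW_pp]
    have := G.le (p + 1)
    constructor
    · intro h; omega
    · rintro ⟨a, _, h⟩; exact absurd h (shP_ne _ _)
  · rw [shP_mem hp, insW_sh]
    constructor
    · rintro ⟨h, h'⟩
      refine ⟨i, ?_, rfl⟩
      by_cases hi : i = p
      · exact Or.inl hi
      · rw [insW_sh_succ _ _ _ _ hi] at h'; exact Or.inr ⟨hi, h, h'⟩
    · rintro ⟨a, ha, e⟩
      obtain rfl := shP_inj _ e
      rcases ha with rfl | ⟨ha, h, h'⟩
      · rw [insW_p_succ]; have := G.le a; omega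
      · rw [insW_sh_succ _ _ _ _ ha]; exact ⟨h, h'⟩

lemma Pset_ins {m p : ℕ} {w : ℕ → ℕ} (G : GoodW m w) (hp1 : 1 ≤ p) (hp : p ≤ m) :
    (Pset (m + 1) (insW m p w)).card = ((Pset m w).erase p).card := by
  classical
  rw [← card_image_of_injective ((Pset m w).erase p) (shP_inj p)]
  congr 1
  ext k
  simp only [mem_Pset, mem_image, mem_erase, PP]
  rcases shP_cases p k with rfl | ⟨i, rfl⟩
  · rw [insW_p, insW_pp]
    constructor
    · rintro ⟨h, h1, i, h2, h3, h4, h5⟩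
      rcases shP_cases p i with rfl | ⟨i, rfl⟩
      · omega
      · rw [insW_sh] at h4; have := G.le i; omega
    · rintro ⟨a, _, h⟩; exact absurd h (shP_ne _ _)
  · rw [shP_mem hp, insW_sh]
    constructor
    · rintro ⟨h, h1, i', h2, h3, h4, h5⟩
      refine ⟨i, ?_, rfl⟩
      have hip : i ≠ p := by
        rintro rfl; rw [insW_p_succ] at h1; have := G.le i; omega
      rw [insW_sh_succ _ _ _ _ hip] at h1
      refine ⟨hip, h, h1, ?_⟩
      rcases shP_cases p i' with rfl | ⟨i', rfl⟩
      · have h6 := h5 p hp1 (by omega)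
        rw [insW_p] at h6
        have : insW m p w p = w p := by simp [insW]
        have := G.le p; omega
      · rw [insW_sh] at h4 h5
        refine ⟨i', ((shP_mem hp).1 ⟨h2, by have := (shP_mem (i := i) hp).2 h; omega⟩).1,
          shP_lt.1 h3, h4, fun j hj hj' => ?_⟩
        have := h5 (shP p j) (by simp only [shP]; split_ifs <;> omega) (shP_lt.2 hj')
        rwa [insW_sh] at this
    · rintro ⟨a, ⟨ha, h, h1, i', h2, h3, h4, h5⟩, e⟩
      obtain rfl := shP_inj _ e
      rw [insW_sh_succ _ _ _ _ ha]
      refine ⟨h, h1, shP p i', by simp only [shP]; split_ifs <;> omega, shP_lt.2 h3,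
        by rw [insW_sh, h4], fun j hj hj' => ?_⟩
      rw [insW_sh]
      rcases shP_cases p j with rfl | ⟨j, rfl⟩
      · rw [insW_p]; have := G.le i'; omega
      · rw [insW_sh]
        refine h5 j ?_ (shP_lt.1 hj')
        simp only [shP] at hj; split_ifs at hj <;> omega

lemma Pset_ins_zero {m : ℕ} {w : ℕ → ℕ} (G : GoodW m w) (hm : 1 ≤ m) :
    (Pset (m + 1) (insW m 0 w)).card = (Pset m w).card + 1 := by
  classical
  obtain ⟨q, hq1, hq2, hq⟩ := G.surj m hm le_rfl
  have hqn : q ∉ Pset m w := by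
    simp only [mem_Pset, PP]
    rintro ⟨_, _, i, _, _, h, _⟩
    have := G.le i; omega
  rw [← card_insert_of_notMem hqn, ← card_image_of_injective (insert _ _) (shP_inj 0)]
  congr 1
  ext k
  simp only [mem_Pset, mem_image, mem_insert, PP]
  rcases shP_cases 0 k with rfl | ⟨i, rfl⟩
  · constructor
    · rintro ⟨h, h1, i, h2, h3, h4, h5⟩
      omega
    · rintro ⟨a, _, h⟩; exact absurd h (shP_ne _ _)
  · rw [shP_mem (Nat.zero_le _), insW_sh]
    constructor
    · rintro ⟨h, h1, i', h2, h3, h4, h5⟩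
      refine ⟨i, ?_, rfl⟩
      rw [insW_sh_succ _ _ _ _ (by omega)] at h1
      rcases shP_cases 0 i' with rfl | ⟨i', rfl⟩
      · left
        rw [insW_p] at h4
        exact G.inj i q h.1 h.2 (by omega)
      · right
        rw [insW_sh] at h4 h5
        have hi' : 1 ≤ i' := by
          by_contra hc
          have := G.out i' (by omega)
          omega
        refine ⟨h, h1, i', hi',
          shP_lt.1 h3, h4, fun j hj hj' => ?_⟩
        have := h5 (shP 0 j) (by simp only [shP]; split_ifs <;> omega) (shP_lt.2 hj')
        rwa [insW_sh] at this
    · rintro ⟨a, ha, e⟩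
      obtain rfl := shP_inj _ e
      have key : 1 ≤ a → insW m 0 w (shP 0 a + 1) = w (a + 1) := fun h =>
        insW_sh_succ _ _ _ _ (by omega)
      rcases ha with rfl | ⟨h, h1, i', h2, h3, h4, h5⟩
      · rw [key hq1]
        refine ⟨⟨hq1, hq2⟩, ?_, 1, le_rfl, by simp only [shP]; split_ifs <;> omega, ?_, fun j _ _ => by omega⟩
        · rcases (G.le (a + 1)).lt_or_eq with h | h
          · omega
          · have := G.inj a (a + 1) hq1 hq2 (by omega); omega
        · have := insW_p m 0 w
          simp only [zero_add] at this
          rw [this, hq]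
      · rw [key h.1]
        refine ⟨h, h1, shP 0 i', by simp only [shP]; split_ifs <;> omega, shP_lt.2 h3,
          by rw [insW_sh, h4], fun j hj hj' => ?_⟩
        rw [insW_sh]
        rcases shP_cases 0 j with rfl | ⟨j, rfl⟩
        · rw [insW_p]; have := G.le i'; omega
        · rw [insW_sh]
          by_cases hj1 : 1 ≤ j
          · exact h5 j hj1 (shP_lt.1 hj')
          · simp only [shP] at hj; split_ifs at hj <;> omega

/-- The insertion operator on functions of two statistics. -/
def TT (n : ℕ) (g : ℕ → ℕ → ℝ) (e f : ℕ) : ℝ :=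
  g e (f + 1) + e * g e f + f * g (e + 1) (f - 1) + ((n : ℝ) - e - f) * g (e + 1) f

lemma sum_split {α : Type*} [DecidableEq α] (S B P : Finset α) (hB : B ⊆ S) (hP : P ⊆ S)
    (hd : Disjoint B P) (g : ℕ → ℕ → ℝ) :
    ∑ p ∈ S, g ((B.erase p).card + 1) (P.erase p).card =
      B.card * g B.card P.card + P.card * g (B.card + 1) (P.card - 1)
        + ((S.card : ℝ) - B.card - P.card) * g (B.card + 1) P.card := by
  have h1 : B ∪ P ⊆ S := union_subset hB hP
  rw [← sum_sdiff h1, sum_union hd]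
  have e1 : ∑ p ∈ B, g ((B.erase p).card + 1) (P.erase p).card = B.card * g B.card P.card := by
    rw [← nsmul_eq_mul, ← sum_const]
    refine sum_congr rfl fun p hp => ?_
    rw [card_erase_add_one hp, erase_eq_of_notMem (disjoint_left.1 hd hp)]
  have e2 : ∑ p ∈ P, g ((B.erase p).card + 1) (P.erase p).card
      = P.card * g (B.card + 1) (P.card - 1) := by
    rw [← nsmul_eq_mul, ← sum_const]
    refine sum_congr rfl fun p hp => ?_
    rw [card_erase_of_mem hp, erase_eq_of_notMem (disjoint_right.1 hd hp)]
  have e3 : ∑ p ∈ S \ (B ∪ P), g ((B.erase p).card + 1) (P.erase p).card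
      = ((S.card : ℝ) - B.card - P.card) * g (B.card + 1) P.card := by
    have hc : ((S \ (B ∪ P)).card : ℝ) = (S.card : ℝ) - B.card - P.card := by
      rw [cast_card_sdiff h1, card_union_of_disjoint hd]; push_cast; ring
    rw [← hc, ← nsmul_eq_mul, ← sum_const]
    refine sum_congr rfl fun p hp => ?_
    simp only [mem_sdiff, mem_union, not_or] at hp
    rw [erase_eq_of_notMem hp.2.1, erase_eq_of_notMem hp.2.2]
  rw [e1, e2, e3]; ring

/-! Insertion of the maximum into the one-line word. -/

def insPerm {m : ℕ} (p : Fin (m + 1)) (π : Equiv.Perm (Fin m)) : Equiv.Perm (Fin (m + 1)) :=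
  ((finSuccEquiv' p).trans (Equiv.optionCongr π)).trans (finSuccEquiv' (Fin.last m)).symm

lemma insPerm_self {m : ℕ} (p : Fin (m + 1)) (π : Equiv.Perm (Fin m)) :
    insPerm p π p = Fin.last m := by simp [insPerm]

lemma insPerm_succAbove {m : ℕ} (p : Fin (m + 1)) (π : Equiv.Perm (Fin m)) (i : Fin m) :
    insPerm p π (p.succAbove i) = (π i).castSucc := by simp [insPerm]

lemma insPerm_bij (m : ℕ) : Function.Bijective
    (fun q : Fin (m + 1) × Equiv.Perm (Fin m) => insPerm q.1 q.2) := by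
  rw [Fintype.bijective_iff_injective_and_card]
  constructor
  · rintro ⟨p, π⟩ ⟨p', π'⟩ h
    simp only at h
    have hp : p = p' := by
      apply (insPerm p π).injective
      rw [insPerm_self, h, insPerm_self]
    subst hp
    congr 1
    ext i
    have := insPerm_succAbove p π i
    rw [h, insPerm_succAbove] at this
    exact (congrArg Fin.val this).symm
  · simp [Fintype.card_perm, Nat.factorial_succ]

lemma word_ins {m : ℕ} (p : Fin (m + 1)) (π : Equiv.Perm (Fin m)) :
    word (insPerm p π) = insW m p (word π) := by
  funext k
  rcases shP_cases p k with rfl | ⟨i, rfl⟩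
  · rw [insW_p]
    have : (p : ℕ) + 1 ≤ m + 1 := by omega
    simp [word, this, insPerm_self]
  · rw [insW_sh]
    have hp : (p : ℕ) ≤ m := by omega
    unfold word
    by_cases h : 1 ≤ i ∧ i ≤ m
    · rw [dif_pos h, dif_pos ((shP_mem hp).2 h)]
      have e : (⟨shP p i - 1, by have := (shP_mem hp).2 h; omega⟩ : Fin (m + 1))
          = p.succAbove ⟨i - 1, by omega⟩ := by
        ext
        simp only [shP, Fin.succAbove, Fin.lt_def, Fin.val_castSucc]
        split_ifs <;> simp <;> omega
      rw [e, insPerm_succAbove]; simp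
    · rw [dif_neg h, dif_neg (fun h' => h ((shP_mem hp).1 h'))]

open Classical in
lemma word_side (n : ℕ) (g : ℕ → ℕ → ℝ) :
    ∑ π ∈ univ.filter fun π : Equiv.Perm (Fin (n + 1 + 1)) => simsuc π = 0,
        g (basc π) (plrmin π) =
      ∑ π ∈ univ.filter fun π : Equiv.Perm (Fin (n + 1)) => simsuc π = 0,
        TT n g (basc π) (plrmin π) := by
  rw [sum_filter, ← (insPerm_bij (n + 1)).sum_comp, Fintype.sum_prod_type_right, sum_filter]
  refine sum_congr rfl fun π _ => ?_
  have G := goodW_word π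
  simp only [simsuc_eq, basc_eq, plrmin_eq, word_ins]
  generalize word π = w at *
  rw [Fin.sum_univ_eq_sum_range (fun p => if ¬ SS (n + 1 + 1) (insW (n + 1) p w) then
    g (Bset (n + 1 + 1) (insW (n + 1) p w)).card (Pset (n + 1 + 1) (insW (n + 1) p w)).card else 0)]
  by_cases hs : SS (n + 1) w
  · rw [if_neg (not_not.2 hs)]
    refine sum_eq_zero fun p hp => ?_
    rw [mem_range] at hp
    rw [if_neg]
    rw [not_not, SS_ins G (by omega)]
    exact Or.inl hs
  rw [if_pos hs]
  obtain ⟨q, hq1, hq2, hq⟩ := G.surj (n + 1) (by omega) le_rfl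
  have hr : range (n + 1 + 1) = insert 0 (insert q ((Icc 1 (n + 1)).erase q)) := by
    rw [insert_erase (by simp; omega)]; ext; simp; omega
  have hwq : ∀ i, w i = n + 1 → i = q := fun i hi => (G.inj q i hq1 hq2 (by omega)).symm
  rw [hr, sum_insert (by simp; omega), sum_insert (by simp)]
  rw [if_pos (by rw [SS_ins G (by omega)]; simpa using hs),
    if_neg (by rw [SS_ins G hq2]; simp [hq1, hq])]
  rw [Bset_ins_zero G, Pset_ins_zero G (by omega)]
  have hc : ∀ p ∈ (Icc 1 (n + 1)).erase q, (if ¬ SS (n + 1 + 1) (insW (n + 1) p w) then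
    g (Bset (n + 1 + 1) (insW (n + 1) p w)).card (Pset (n + 1 + 1) (insW (n + 1) p w)).card else 0)
    = g (((Bset (n + 1) w).erase p).card + 1) ((Pset (n + 1) w).erase p).card := by
    intro p hp
    simp only [mem_erase, mem_Icc] at hp
    have hwp : w p ≠ n + 1 := fun h => hp.1 (hwq p h)
    rw [if_pos (by rw [SS_ins G hp.2.2]; tauto), Bset_ins G hp.2.1 hp.2.2 hwp,
      Pset_ins G hp.2.1 hp.2.2]
  rw [sum_congr rfl hc, sum_split]
  · unfold TT
    rw [card_erase_of_mem (by simp; omega)]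
    simp; ring
  · intro i hi
    simp only [Bset, mem_filter, mem_erase] at hi ⊢
    refine ⟨?_, hi.1⟩
    rintro rfl
    have := G.le (i + 1); omega
  · intro i hi
    simp only [mem_Pset, mem_erase, mem_Icc, PP] at hi ⊢
    refine ⟨?_, hi.1⟩
    rintro rfl
    obtain ⟨_, _, j, _, _, h, _⟩ := hi
    have := G.le j; omega
  · rw [disjoint_left]
    intro i hi hi'
    simp only [Bset, mem_Pset, mem_filter, PP] at hi hi'
    omega

lemma perm_side (n : ℕ) (g : ℕ → ℕ → ℝ) :
    ∑ σ : Equiv.Perm (Fin (n + 1)), g (excStat σ) (fixStat σ) =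
      ∑ σ : Equiv.Perm (Fin n), TT n g (excStat σ) (fixStat σ) := by
  rw [← Equiv.Perm.decomposeFin.symm.sum_comp, Fintype.sum_prod_type_right]
  refine sum_congr rfl fun σ _ => ?_
  rw [Fin.sum_univ_succ]
  have h0 : excStat (Equiv.Perm.decomposeFin.symm (0, σ)) = excStat σ := by
    unfold excStat
    rw [← card_map (Fin.succEmb n)]
    congr 1
    ext i
    refine Fin.cases ?_ (fun i => ?_) i <;> simp
  have h0' : fixStat (Equiv.Perm.decomposeFin.symm (0, σ)) = fixStat σ + 1 := by
    unfold fixStat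
    rw [← card_map (Fin.succEmb n), ← card_insert_of_notMem (a := (0 : Fin (n + 1))) (by simp)]
    congr 1
    ext i
    refine Fin.cases ?_ (fun i => ?_) i <;> simp
  have h1 : ∀ i : Fin n, excStat (Equiv.Perm.decomposeFin.symm ((σ i).succ, σ))
      = ((univ.filter fun i : Fin n => i < σ i).erase i).card + 1 := by
    intro i
    unfold excStat
    rw [← card_map (Fin.succEmb n), ← card_insert_of_notMem (a := (0 : Fin (n + 1))) (by simp)]
    congr 1
    ext j
    refine Fin.cases ?_ (fun j => ?_) j
    · simp
    · by_cases h : j = i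
      · subst h; simp
      · have : (σ j).succ ≠ (σ i).succ := by simpa using h
        simp [h, Equiv.swap_apply_of_ne_of_ne, this]
  have h1' : ∀ i : Fin n, fixStat (Equiv.Perm.decomposeFin.symm ((σ i).succ, σ))
      = ((univ.filter fun i : Fin n => σ i = i).erase i).card := by
    intro i
    unfold fixStat
    rw [← card_map (Fin.succEmb n)]
    congr 1
    ext j
    refine Fin.cases ?_ (fun j => ?_) j
    · simp
    · by_cases h : j = i
      · subst h; simp [Fin.succ_ne_zero, (Fin.succ_ne_zero _).symm]
      · have : (σ j).succ ≠ (σ i).succ := by simpa using h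
        simp [h, Equiv.swap_apply_of_ne_of_ne, this]
  rw [h0, h0', ← Equiv.sum_comp σ]
  simp only [h1, h1']
  rw [sum_split _ _ _ (filter_subset _ _) (filter_subset _ _)]
  · unfold TT excStat fixStat
    simp; ring
  · rw [disjoint_left]
    intro i hi hi'
    simp only [mem_filter] at hi hi'
    exact absurd hi'.2 hi.2.ne'

open Classical in
lemma general (n : ℕ) : ∀ (g : ℕ → ℕ → ℝ),
    ∑ π ∈ univ.filter fun π : Equiv.Perm (Fin (n + 1)) => simsuc π = 0,
        g (basc π) (plrmin π) =
      ∑ σ : Equiv.Perm (Fin n), g (excStat σ) (fixStat σ) := by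
  induction n with
  | zero =>
    intro g
    have hS : ∀ π : Equiv.Perm (Fin 1), simsuc π = 0 := by
      intro π; rw [simsuc_eq]
      rintro ⟨i, j, h⟩; omega
    have hB : ∀ π : Equiv.Perm (Fin 1), basc π = 0 := by
      intro π; simp [basc]
    have hP : ∀ π : Equiv.Perm (Fin 1), plrmin π = 0 := by
      intro π; rw [plrmin_eq, card_eq_zero, eq_empty_iff_forall_notMem]
      intro k hk
      rw [mem_Pset] at hk
      obtain ⟨hk, _, i, h⟩ := hk
      omega
    simp [hS, hB, hP, excStat, fixStat]
  | succ n ih =>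
    intro g
    rw [word_side, perm_side, ih]

open Classical in
/-- `Σ_{π ∈ S_{n+1}, simsuc(π)=0} x^basc t^plrmin
= Σ_{σ ∈ S_n} x^exc t^fix`. -/
theorem statement19 (n : ℕ) (x t : ℝ) :
    ∑ π ∈ Finset.univ.filter fun π : Equiv.Perm (Fin (n + 1)) => simsuc π = 0,
        x ^ basc π * t ^ plrmin π =
      ∑ σ : Equiv.Perm (Fin n), x ^ excStat σ * t ^ fixStat σ := by
  exact general n (fun a b => x ^ a * t ^ b)

end SucEuler
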